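/- Assume f(x) = C·exp(−ψ(‖x‖)), x ∈ ℝ^d, where C > 0 is a normalizing constant and ψ : (0,∞) → ℝ is C² with ψ′ > 0 and ψ regularly varying at infinity with index v for some v > 0. Set δ₁ = d·log 2 − log v + (1 + d/2)·log d − log C and fix δ₂ > 0. With ψ^{←}(u) = inf{ s > 0 : ψ(s) ≥ u }, set R_n^{(w)} = ψ^{←}(log n + log C) and R_n^{(c)} = ψ^{←}(log n − log log log n − δ₁ − δ₂). Then R_n^{(c)}/R_n^{(w)} − (1 − (log log log n + δ₁ + δ₂ + log C)/log(Cn))^{1/v} → 0 as n → ∞. -/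

import Mathlib

open MeasureTheory ProbabilityTheory Filter Topology
open scoped ENNReal NNReal

noncomputable section

/-- Abbreviation for `d`-dimensional Euclidean space. -/
abbrev Euc (d : ℕ) := EuclideanSpace ℝ (Fin d)

/-- The first coordinate unit vector `e₁ ∈ ℝ^d`. -/
def e1 (d : ℕ) : Euc d :=
  if h : 0 < d then EuclideanSpace.single (⟨0, h⟩ : Fin d) 1 else 0

/-- The generalized inverse `ψ^←(u) = inf { s > 0 : u ≤ ψ(s) }`. -/
def psiInv (ψ : ℝ → ℝ) (u : ℝ) : ℝ := sInf {s : ℝ | 0 < s ∧ u ≤ ψ s}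

/-- A strictly increasing function that is regularly varying with positive index diverges. -/
lemma tendsto_atTop_of_strictMonoOn_of_regularlyVarying {ψ : ℝ → ℝ}
    (hmono : StrictMonoOn ψ (Set.Ioi 0)) {v : ℝ} (hv : 0 < v)
    (hrv : ∀ u > (0 : ℝ), Tendsto (fun z : ℝ => ψ (z * u) / ψ z) atTop (𝓝 (u ^ v))) :
    Tendsto ψ atTop atTop := by
  have h2v : (1 : ℝ) < 2 ^ v := Real.one_lt_rpow (by norm_num) hv
  obtain ⟨c, hc1, hc2⟩ := exists_between h2v
  obtain ⟨N, hN⟩ := eventually_atTop.1 ((hrv 2 two_pos).eventually (lt_mem_nhds hc2))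
  have hpos : ∃ z₀ : ℝ, 0 < z₀ ∧ N ≤ z₀ ∧ 0 < ψ z₀ := by
    by_contra! h
    set z := max N 1
    have hz : 0 < z := lt_of_lt_of_le one_pos (le_max_right _ _)
    have hNz : N ≤ z := le_max_left _ _
    have h1 := hN z hNz
    have h3 : ψ z < ψ (z * 2) :=
      hmono (Set.mem_Ioi.2 hz) (Set.mem_Ioi.2 (by linarith)) (by linarith)
    have h4 := h (z * 2) (by linarith) (by linarith)
    have h5 : ψ z < 0 := by linarith
    rw [lt_div_iff_of_neg h5] at h1
    nlinarith
  obtain ⟨z₀, hz₀, hNz₀, hψz₀⟩ := hpos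
  have hgrow : ∀ k : ℕ, c ^ k * ψ z₀ ≤ ψ (z₀ * 2 ^ k) := by
    intro k
    induction k with
    | zero => simp
    | succ k ih =>
      have hk : (1 : ℝ) ≤ 2 ^ k := one_le_pow₀ (by norm_num)
      have h1 := hN (z₀ * 2 ^ k) (by nlinarith)
      have h2 : 0 < ψ (z₀ * 2 ^ k) := lt_of_lt_of_le (by positivity) ih
      rw [lt_div_iff₀ h2] at h1
      calc c ^ (k + 1) * ψ z₀ = c * (c ^ k * ψ z₀) := by ring
        _ ≤ c * ψ (z₀ * 2 ^ k) := by gcongr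
        _ ≤ ψ (z₀ * 2 ^ k * 2) := h1.le
        _ = ψ (z₀ * 2 ^ (k + 1)) := by ring_nf
  refine tendsto_atTop.2 fun M => ?_
  obtain ⟨k, hk⟩ := (((tendsto_pow_atTop_atTop_of_one_lt hc1).atTop_mul_const
    hψz₀).eventually_ge_atTop M).exists
  filter_upwards [eventually_ge_atTop (z₀ * 2 ^ k)] with z hz
  have hz' : 0 < z₀ * 2 ^ k := by positivity
  exact (hk.trans (hgrow k)).trans
    (hmono.monotoneOn (Set.mem_Ioi.2 hz') (Set.mem_Ioi.2 (hz'.trans_le hz)) hz)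

/-- The generalized inverse is eventually a positive right inverse. -/
lemma eventually_psiInv_pos_and_apply_psiInv {ψ : ℝ → ℝ} (hmono : StrictMonoOn ψ (Set.Ioi 0))
    (hcont : ContinuousOn ψ (Set.Ioi 0)) (htop : Tendsto ψ atTop atTop) :
    ∀ᶠ u in atTop, 0 < psiInv ψ u ∧ ψ (psiInv ψ u) = u := by
  filter_upwards [eventually_ge_atTop (ψ 1)] with u hu
  obtain ⟨b, hub, hb⟩ := ((htop.eventually_ge_atTop u).and (eventually_ge_atTop 1)).exists
  obtain ⟨s, hs, rfl⟩ := intermediate_value_Icc hb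
    (hcont.mono fun x hx => lt_of_lt_of_le one_pos hx.1) ⟨hu, hub⟩
  have hs0 : 0 < s := lt_of_lt_of_le one_pos hs.1
  have hset : {t : ℝ | 0 < t ∧ ψ s ≤ ψ t} = Set.Ici s := by
    ext t
    refine ⟨fun ht => (hmono.le_iff_le (Set.mem_Ioi.2 hs0) (Set.mem_Ioi.2 ht.1)).1 ht.2,
      fun ht => ?_⟩
    have ht0 : 0 < t := hs0.trans_le ht
    exact ⟨ht0, (hmono.le_iff_le (Set.mem_Ioi.2 hs0) (Set.mem_Ioi.2 ht0)).2 ht⟩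
  have hinv : psiInv ψ (ψ s) = s := by rw [psiInv, hset, csInf_Ici]
  rw [hinv]
  exact ⟨hs0, rfl⟩

/-- The generalized inverse of a regularly varying function of positive index preserves
asymptotic equivalence. -/
lemma tendsto_psiInv_div_psiInv {ψ : ℝ → ℝ} (hmono : StrictMonoOn ψ (Set.Ioi 0))
    (hcont : ContinuousOn ψ (Set.Ioi 0)) {v : ℝ} (hv : 0 < v)
    (hrv : ∀ u > (0 : ℝ), Tendsto (fun z : ℝ => ψ (z * u) / ψ z) atTop (𝓝 (u ^ v)))
    {ι : Type*} {l : Filter ι} {a b : ι → ℝ} (ha : Tendsto a l atTop) (hb : Tendsto b l atTop)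
    (hba : Tendsto (fun n => b n / a n) l (𝓝 1)) :
    Tendsto (fun n => psiInv ψ (b n) / psiInv ψ (a n)) l (𝓝 1) := by
  have htop := tendsto_atTop_of_strictMonoOn_of_regularlyVarying hmono hv hrv
  have hinv := eventually_psiInv_pos_and_apply_psiInv hmono hcont htop
  have hA := ha.eventually hinv
  have hB := hb.eventually hinv
  have hinf : Tendsto (fun n => psiInv ψ (a n)) l atTop := by
    refine tendsto_atTop.2 fun M => ?_
    filter_upwards [hA, ha.eventually_gt_atTop (ψ (max M 1))] with n hn hn'
    rw [← hn.2] at hn'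
    exact (le_max_left M 1).trans ((hmono.lt_iff_lt
      (Set.mem_Ioi.2 (lt_of_lt_of_le one_pos (le_max_right _ _))) (Set.mem_Ioi.2 hn.1)).1 hn').le
  have hscale : ∀ t > (0 : ℝ), Tendsto (fun n => ψ (psiInv ψ (a n) * t) / a n) l (𝓝 (t ^ v)) := by
    intro t ht
    refine ((hrv t ht).comp hinf).congr' ?_
    filter_upwards [hA] with n hn
    simp only [Function.comp_apply, hn.2]
  refine tendsto_order.2 ⟨fun t ht => ?_, fun t ht => ?_⟩
  · rcases le_or_gt t 0 with ht0 | ht0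
    · filter_upwards [hA, hB] with n hn hn'
      exact ht0.trans_lt (div_pos hn'.1 hn.1)
    · filter_upwards [hA, hB, ha.eventually_gt_atTop 0,
        (hscale t ht0).eventually_lt hba (Real.rpow_lt_one ht0.le ht hv)] with n hn hn' hpos hlt
      rw [div_lt_div_iff_of_pos_right hpos, ← hn'.2, hmono.lt_iff_lt
        (Set.mem_Ioi.2 (mul_pos hn.1 ht0)) (Set.mem_Ioi.2 hn'.1)] at hlt
      rwa [lt_div_iff₀ hn.1, mul_comm]
  · have ht0 : 0 < t := one_pos.trans ht
    filter_upwards [hA, hB, ha.eventually_gt_atTop 0,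
      hba.eventually_lt (hscale t ht0) (Real.one_lt_rpow ht hv)] with n hn hn' hpos hlt
    rw [div_lt_div_iff_of_pos_right hpos] at hlt
    have hlt' : ψ (psiInv ψ (b n)) < ψ (psiInv ψ (a n) * t) := by rwa [hn'.2]
    rw [hmono.lt_iff_lt (Set.mem_Ioi.2 hn'.1) (Set.mem_Ioi.2 (mul_pos hn.1 ht0))] at hlt'
    rwa [div_lt_iff₀ hn.1, mul_comm]

/-- `log log x + k` is negligible compared with `x + c`. -/
lemma tendsto_log_log_add_const_div (k c : ℝ) :
    Tendsto (fun x : ℝ => (Real.log (Real.log x) + k) / (x + c)) atTop (𝓝 0) := by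
  have hlog : (fun x : ℝ => Real.log (Real.log x)) =o[atTop] (id : ℝ → ℝ) :=
    (Real.isLittleO_log_id_atTop.comp_tendsto Real.tendsto_log_atTop).trans
      Real.isLittleO_log_id_atTop
  have hnum : (fun x : ℝ => Real.log (Real.log x) + k) =o[atTop] (id : ℝ → ℝ) :=
    hlog.add (Asymptotics.isLittleO_const_id_atTop k)
  have hden : (id : ℝ → ℝ) =O[atTop] (fun x : ℝ => x + c) := by
    refine Asymptotics.IsBigO.of_bound 2 ?_
    filter_upwards [eventually_ge_atTop (2 * |c|), eventually_ge_atTop 0] with x hx hx0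
    have hc := neg_abs_le c
    rw [id, Real.norm_of_nonneg hx0, Real.norm_of_nonneg (by linarith [abs_nonneg c])]
    linarith
  exact (hnum.trans_isBigO hden).tendsto_div_nhds_zero

/-- **The maximal core radius and the weak core radius are close in size
(exponentially decaying tail case).** -/
theorem core_weakCore_comparison_light
    (d : ℕ) (hd : 1 ≤ d)
    (f : Euc d → ℝ) (hf_meas : Measurable f) (hf_nonneg : ∀ x, 0 ≤ f x)
    (hf_symm : ∀ x y : Euc d, ‖x‖ = ‖y‖ → f x = f y)
    (C : ℝ) (hC : 0 < C)
    (ψ : ℝ → ℝ) (hψC2 : ContDiffOn ℝ 2 ψ (Set.Ioi (0 : ℝ)))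
    (hψ' : ∀ z > (0 : ℝ), 0 < deriv ψ z)
    (v : ℝ) (hv : 0 < v)
    (hψ_rv : ∀ u > (0 : ℝ), Tendsto (fun z : ℝ => ψ (z * u) / ψ z) atTop (𝓝 (u ^ v)))
    (hfψ : ∀ x : Euc d, f x = C * Real.exp (-ψ ‖x‖))
    (δ₁ δ₂ : ℝ)
    (hδ₁ : δ₁ = d * Real.log 2 - Real.log v + (1 + (d : ℝ) / 2) * Real.log d - Real.log C)
    (hδ₂ : 0 < δ₂)
    (Rw Rc : ℕ → ℝ)
    (hRw : ∀ n : ℕ, Rw n = psiInv ψ (Real.log n + Real.log C))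
    (hRc : ∀ n : ℕ, Rc n =
      psiInv ψ (Real.log n - Real.log (Real.log (Real.log n)) - δ₁ - δ₂)) :
    Tendsto (fun n : ℕ => Rc n / Rw n -
        (1 - (Real.log (Real.log (Real.log n)) + δ₁ + δ₂ + Real.log C) /
          Real.log (C * n)) ^ (1 / v))
      atTop (𝓝 0) := by
  have hmono : StrictMonoOn ψ (Set.Ioi 0) :=
    strictMonoOn_of_deriv_pos (convex_Ioi 0) hψC2.continuousOn fun z hz =>
      hψ' z (by simpa using hz)
  have hlogn : Tendsto (fun n : ℕ => Real.log n) atTop atTop :=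
    Real.tendsto_log_atTop.comp tendsto_natCast_atTop_atTop
  set a : ℕ → ℝ := fun n => Real.log n + Real.log C with ha_def
  set b : ℕ → ℝ := fun n => Real.log n - Real.log (Real.log (Real.log n)) - δ₁ - δ₂ with hb_def
  have ha : Tendsto a atTop atTop := tendsto_atTop_add_const_right _ _ hlogn
  have hg : Tendsto (fun n : ℕ => 1 - (Real.log (Real.log (Real.log n)) + δ₁ + δ₂ + Real.log C) /
      a n) atTop (𝓝 1) := by
    have h := ((tendsto_log_log_add_const_div (δ₁ + δ₂ + Real.log C) (Real.log C)).comp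
      hlogn).const_sub 1
    simpa only [Function.comp_def, sub_zero, add_assoc, ha_def] using h
  have hba : Tendsto (fun n => b n / a n) atTop (𝓝 1) := by
    refine hg.congr' ?_
    filter_upwards [ha.eventually_gt_atTop 0] with n hn
    rw [eq_div_iff hn.ne', sub_mul, div_mul_cancel₀ _ hn.ne']
    simp only [ha_def, hb_def]
    ring
  have hb : Tendsto b atTop atTop := by
    refine (hba.pos_mul_atTop one_pos ha).congr' ?_
    filter_upwards [ha.eventually_gt_atTop 0] with n hn
    exact div_mul_cancel₀ _ hn.ne'
  have hratio := tendsto_psiInv_div_psiInv hmono hψC2.continuousOn hv hψ_rv ha hb hba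
  have hpow := hg.rpow_const (p := 1 / v) (Or.inl one_ne_zero)
  have hdiff := hratio.sub hpow
  rw [Real.one_rpow, sub_self] at hdiff
  refine hdiff.congr' ?_
  filter_upwards [eventually_gt_atTop 0] with n hn
  rw [hRc, hRw, Real.log_mul hC.ne' (Nat.cast_pos.2 hn).ne', add_comm (Real.log C)]

end
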